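/- For every n ≥ 2, the code B_n of the even-length Construction 4 is a cyclic 1-skew-tolerant binary Gray code of length N = 2n+2 and size (3/8)·2^N − 4. -/

import Mathlib

/-- Codewords `c` and `d` differ exactly at coordinate `i` (1-based), by `±1` there. -/
def TransAt {m : ℕ} (c d : List (ZMod m)) (i : ℕ) : Prop :=
  1 ≤ i ∧ i ≤ c.length ∧ c.length = d.length ∧
  c.take (i-1) = d.take (i-1) ∧ c.drop i = d.drop i ∧
  (d.getD (i-1) 0 = c.getD (i-1) 0 + 1 ∨ d.getD (i-1) 0 = c.getD (i-1) 0 - 1)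

/-- Cyclic Gray code whose transition positions `δ` are integers;
position `p ∈ ℤ` corresponds to 1-based coordinate `p + o`. -/
def CyclicGrayZ {m : ℕ} (C : List (List (ZMod m))) (o : ℕ) (δ : ℕ → ℤ) : Prop :=
  C.Nodup ∧ ∀ i < C.length, ∃ j : ℕ, (j : ℤ) = δ i + o ∧
    TransAt (C.getD i []) (C.getD ((i+1) % C.length) []) j

/-- Non-cyclic Gray code with integer transition positions, offset `o`. -/
def PathGrayZ {m : ℕ} (C : List (List (ZMod m))) (o : ℕ) (δ : ℕ → ℤ) : Prop :=
  C.Nodup ∧ ∀ i, i + 1 < C.length → ∃ j : ℕ, (j : ℤ) = δ i + o ∧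
    TransAt (C.getD i []) (C.getD (i+1) []) j

/-- `B_{n+1}` from `A_n` in Construction 3: the all-zero word followed by the four blocks
`(0,A_n,1)`, `(1,reverse A_n,1)`, `(1,A_n,0)`, `(0, reverse of A_n minus first word ,0)`. -/
def buildB3 (An : List (List (ZMod 2))) (len : ℕ) : List (List (ZMod 2)) :=
  List.replicate len (0 : ZMod 2) ::
    (An.map (fun c => 0 :: c ++ [1]) ++ An.reverse.map (fun c => 1 :: c ++ [1]) ++
     An.map (fun c => 1 :: c ++ [0]) ++ An.tail.reverse.map (fun c => 0 :: c ++ [0]))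

/-- The words `Σ_{i=1}^{j} e_{-i} + Σ_{i=1}^{n} e_i`, `j = 1, …, n+1`,
as lists of length `2n+3` (positions `-(n+1), …, n+1`). -/
def newWords (n : ℕ) : List (List (ZMod 2)) :=
  (List.range (n+1)).map (fun j =>
    List.replicate (n-j) (0 : ZMod 2) ++ List.replicate (j+1) 1 ++ [0] ++
      List.replicate n 1 ++ [0])

/-- Construction 3, codes `A_n` (length `2n+1`, positions `-n, …, n`). -/
def c3A : ℕ → List (List (ZMod 2))
  | 0 => []
  | 1 => [[0,0,0],[0,0,1],[0,1,1],[1,1,1]]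
  | (n+2) =>
    let B := buildB3 (c3A (n+1)) (2*n+5)
    B.take (B.length - n) ++ newWords (n+1)

/-- Construction 3, codes `B_n` (length `2n+1`). -/
def c3B : ℕ → List (List (ZMod 2))
  | 0 => []
  | (n+1) => buildB3 (c3A n) (2*n+3)

/-- The words `Σ_{i=1}^{j} e_{-i} + Σ_{i=1}^{n} e_i`, `j = 1, …, n+2`,
as lists of length `2n+4` (positions `-(n+2), …, n+1`). -/
def newWordsE (n : ℕ) : List (List (ZMod 2)) :=
  (List.range (n+2)).map (fun j =>
    List.replicate (n+1-j) (0 : ZMod 2) ++ List.replicate (j+1) 1 ++ [0] ++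
      List.replicate n 1 ++ [0])

/-- Construction 4 (even length), codes `A_n` (length `2n+2`, positions `-(n+1), …, n`). -/
def c4A : ℕ → List (List (ZMod 2))
  | 0 => []
  | 1 => [[0,0,0,0],[0,0,0,1],[0,0,1,1],[0,1,1,1],[1,1,1,1]]
  | (n+2) =>
    let B := buildB3 (c4A (n+1)) (2*n+6)
    B.take (B.length - n) ++ newWordsE (n+1)

/-- Construction 4 (even length), codes `B_n` (length `2n+2`). -/
def c4B : ℕ → List (List (ZMod 2))
  | 0 => []
  | (n+1) => buildB3 (c4A n) (2*n+4)

/-- `d` arises from `c` by flipping the bit at the 1-based coordinate `i`. -/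
def Flips (c d : List (ZMod 2)) (i : ℕ) : Prop :=
  ∃ a b x, c = a ++ x :: b ∧ d = a ++ (x + 1) :: b ∧ i = a.length + 1

/-- `FlipPath c ds d L`: the list of words `L` starts at `c`, ends at `d`, and its successive
words differ by flips at the coordinates listed in `ds`. -/
inductive FlipPath : List (ZMod 2) → List ℕ → List (ZMod 2) → List (List (ZMod 2)) → Prop
  | single (c) : FlipPath c [] c [c]
  | cons {c d e i ds L} : Flips c d i → FlipPath d ds e L → FlipPath c (i :: ds) e (c :: L)

/-- Two coordinates are equal or adjacent. -/
def Near (a b : ℕ) : Prop := a ≤ b + 1 ∧ b ≤ a + 1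

theorem Near.symm {a b : ℕ} (h : Near a b) : Near b a := ⟨h.2, h.1⟩

theorem Flips.symm {c d : List (ZMod 2)} {i : ℕ} (h : Flips c d i) : Flips d c i := by
  obtain ⟨a, b, x, rfl, rfl, rfl⟩ := h
  refine ⟨a, b, x + 1, rfl, ?_, rfl⟩
  have : x + 1 + 1 = x := by revert x; decide
  rw [this]

theorem Flips.pad {c d : List (ZMod 2)} {i : ℕ} (h : Flips c d i) (x y : ZMod 2) :
    Flips (x :: c ++ [y]) (x :: d ++ [y]) (i + 1) := by
  obtain ⟨a, b, z, rfl, rfl, rfl⟩ := h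
  exact ⟨x :: a, b ++ [y], z, by simp, by simp, by simp⟩

theorem Flips.transAt {c d : List (ZMod 2)} {i : ℕ} (h : Flips c d i) : TransAt c d i := by
  obtain ⟨a, b, x, rfl, rfl, rfl⟩ := h
  refine ⟨by simp, by simp, by simp, by simp, by simp [List.drop_append], ?_⟩
  left
  simp [List.getD]

namespace FlipPath

variable {c d e f : List (ZMod 2)} {i : ℕ} {ds es : List ℕ} {L M : List (List (ZMod 2))}

theorem append (h : FlipPath c ds d L) (hf : Flips d e i) (h' : FlipPath e es f M) :
    FlipPath c (ds ++ i :: es) f (L ++ M) := by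
  induction h with
  | single => exact .cons hf h'
  | cons h₁ _ ih => exact .cons h₁ (ih hf)

theorem reverse (h : FlipPath c ds d L) : FlipPath d ds.reverse c L.reverse := by
  induction h with
  | single => exact .single _
  | cons h₁ _ ih =>
    simp only [List.reverse_cons]
    exact ih.append h₁.symm (.single _)

theorem pad (h : FlipPath c ds d L) (x y : ZMod 2) :
    FlipPath (x :: c ++ [y]) (ds.map (· + 1)) (x :: d ++ [y]) (L.map fun w => x :: w ++ [y]) := by
  induction h with
  | single => exact .single _
  | cons h₁ _ ih => exact .cons (h₁.pad x y) ih

theorem eq_cons (h : FlipPath c ds d L) : ∃ L', L = c :: L' := by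
  cases h <;> exact ⟨_, rfl⟩

theorem length_eq (h : FlipPath c ds d L) : L.length = ds.length + 1 := by
  induction h <;> simp_all

theorem getD_last (h : FlipPath c ds d L) : L.getD ds.length [] = d := by
  induction h <;> simp_all

theorem flips_getD (h : FlipPath c ds d L) :
    ∀ k < ds.length, Flips (L.getD k []) (L.getD (k + 1) []) (ds.getD k 0) := by
  induction h with
  | single => simp
  | cons h₁ h₂ ih =>
    intro k hk
    cases k with
    | zero =>
      obtain ⟨L', rfl⟩ := h₂.eq_cons
      simpa using h₁
    | succ k => simpa using ih k (by simpa using hk)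

theorem ofFn (w : ℕ → List (ZMod 2)) (g : ℕ → ℕ) (k : ℕ)
    (h : ∀ j < k, Flips (w j) (w (j + 1)) (g j)) :
    FlipPath (w 0) ((List.range k).map g) (w k) ((List.range (k + 1)).map w) := by
  induction k with
  | zero => exact .single _
  | succ k ih =>
    rw [List.range_succ, List.range_succ (n := k + 1), List.map_append, List.map_append]
    exact (ih fun j hj => h j (by omega)).append (h k (by omega)) (.single _)

/-- A closed flip path whose consecutive flips are adjacent is a cyclic skew-tolerant code. -/
theorem exists_cyclicGrayZ (h : FlipPath c ds d L) (hc : Flips d c i) (hL : L.Nodup)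
    (hch : (ds ++ [i]).IsChain Near) (hi : ∀ x ∈ ds.head?, Near i x) (o : ℕ) :
    ∃ δ : ℕ → ℤ, CyclicGrayZ L o δ ∧
      ∀ k < L.length, |δ k - δ ((k + 1) % L.length)| ≤ 1 := by
  have hlen := h.length_eq
  refine ⟨fun k => ((ds ++ [i]).getD k 0 : ℤ) - o, ⟨hL, fun k hk => ?_⟩, fun k hk => ?_⟩
  · refine ⟨(ds ++ [i]).getD k 0, by ring, ?_⟩
    apply Flips.transAt
    rcases Nat.lt_or_ge k ds.length with hk' | hk'
    · rw [Nat.mod_eq_of_lt (by omega), List.getD_append _ _ _ _ hk']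
      exact h.flips_getD k hk'
    · obtain rfl : k = ds.length := by omega
      rw [hlen, Nat.mod_self, h.getD_last]
      obtain ⟨L', rfl⟩ := h.eq_cons
      simpa [List.getD] using hc
  · have key : Near ((ds ++ [i]).getD k 0) ((ds ++ [i]).getD ((k + 1) % L.length) 0) := by
      rcases Nat.lt_or_ge k ds.length with hk' | hk'
      · rw [Nat.mod_eq_of_lt (by omega), List.getD_eq_getElem _ _ (by simp; omega),
          List.getD_eq_getElem _ _ (by simp; omega)]
        exact List.isChain_iff_getElem.1 hch k (by simp; omega)
      · obtain rfl : k = ds.length := by omega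
        rw [hlen, Nat.mod_self]
        cases ds with
        | nil => simp [Near]
        | cons x xs => simpa [List.getD] using hi x rfl
    obtain ⟨h₁, h₂⟩ := key
    rw [abs_le]
    constructor <;> push_cast <;> omega

end FlipPath

theorem cons_append_singleton_inj {x x' y y' : ZMod 2} {c c' : List (ZMod 2)} :
    x :: (c ++ [y]) = x' :: (c' ++ [y']) ↔ x = x' ∧ c = c' ∧ y = y' := by
  constructor
  · intro h
    have := List.append_inj' (List.cons.inj h).2 rfl
    simp_all
  · rintro ⟨rfl, rfl, rfl⟩; rfl

theorem replicate_add_two_eq (k : ℕ) :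
    List.replicate (k + 2) (0 : ZMod 2) = 0 :: List.replicate k 0 ++ [0] := by
  rw [List.replicate_succ, List.replicate_succ']; rfl

/-- The word `Σ_{i=1}^{j+1} e_{-i} + Σ_{i=1}^{n} e_i` of length `2n+2`. -/
def gapWord (n j : ℕ) : List (ZMod 2) :=
  List.replicate (n - j) 0 ++ List.replicate (j + 1) 1 ++ [0] ++ List.replicate n 1

/-- The word `Σ_{i=1}^{n} e_i` of length `2n+2`. -/
def halfWord (n : ℕ) : List (ZMod 2) :=
  List.replicate (n + 2) 0 ++ List.replicate n 1

theorem halfWord_succ (n : ℕ) : halfWord (n + 1) = 0 :: halfWord n ++ [1] := by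
  simp [halfWord, List.replicate_succ (n := n + 2), List.replicate_succ' (n := n)]

theorem gapWord_succ_of_le {n j : ℕ} (h : j ≤ n) :
    gapWord (n + 1) j = 0 :: (gapWord n j ++ [1]) := by
  have : n + 1 - j = n - j + 1 := by omega
  simp [gapWord, this, List.replicate_succ (n := n - j), List.replicate_succ' (n := n)]

theorem gapWord_succ_self (n : ℕ) : gapWord (n + 1) (n + 1) = 1 :: (gapWord n n ++ [1]) := by
  simp only [gapWord, Nat.sub_self]
  rw [List.replicate_succ (n := n + 1), List.replicate_succ' (n := n)]
  simp

theorem mem_newWordsE {n : ℕ} {c : List (ZMod 2)} : c ∈ newWordsE n ↔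
    (∃ j ≤ n, c = 0 :: (gapWord n j ++ [0])) ∨ c = 1 :: (gapWord n n ++ [0]) := by
  have h₁ : ∀ j ≤ n, List.replicate (n+1-j) (0 : ZMod 2) ++ List.replicate (j+1) 1 ++ [0] ++
      List.replicate n 1 ++ [0] = 0 :: (gapWord n j ++ [0]) := fun j h => by
    have : n + 1 - j = n - j + 1 := by omega
    simp [gapWord, this, List.replicate_succ (n := n - j)]
  have h₂ : List.replicate (n+1-(n+1)) (0 : ZMod 2) ++ List.replicate (n+1+1) 1 ++ [0] ++
      List.replicate n 1 ++ [0] = 1 :: (gapWord n n ++ [0]) := by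
    simp [gapWord, List.replicate_succ (n := n + 1)]
  rw [newWordsE, List.mem_map]
  constructor
  · rintro ⟨j, hj, rfl⟩
    rw [List.mem_range] at hj
    rcases Nat.lt_or_ge j (n + 1) with h | h
    · exact .inl ⟨j, by omega, h₁ j (by omega)⟩
    · obtain rfl : j = n + 1 := by omega
      exact .inr h₂
  · rintro (⟨j, hj, rfl⟩ | rfl)
    · exact ⟨j, by simp; omega, h₁ j hj⟩
    · exact ⟨n + 1, by simp, h₂⟩

theorem nodup_newWordsE (n : ℕ) : (newWordsE n).Nodup := by
  refine List.Nodup.map_on (fun i hi j hj h => ?_) List.nodup_range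
  simp only [List.mem_range] at hi hj
  have := congrArg (fun l => l.count 1) h
  simpa [List.count_replicate] using this

theorem flipPath_newWordsE (n : ℕ) : ∃ e, FlipPath
    (List.replicate (n + 1) 0 ++ [1, 0] ++ List.replicate n 1 ++ [0])
    ((List.range (n + 1)).map (n + 1 - ·)) e (newWordsE n) := by
  have := FlipPath.ofFn (fun j => List.replicate (n+1-j) (0 : ZMod 2) ++ List.replicate (j+1) 1 ++
    [0] ++ List.replicate n 1 ++ [0]) (n + 1 - ·) (n + 1) fun j hj => by
      have h : n + 1 - j = n - j + 1 := by omega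
      refine ⟨List.replicate (n - j) 0,
        List.replicate (j + 1) 1 ++ [0] ++ List.replicate n 1 ++ [0], 0, ?_, ?_, by simp [h]⟩
      · simp [h, List.replicate_succ' (n := n - j)]
      · simp [List.replicate_succ (n := j + 1)]
  exact ⟨_, by simpa [newWordsE] using this⟩

theorem isChain_map_succ {l : List ℕ} (h : l.IsChain Near) : (l.map (· + 1)).IsChain Near := by
  rw [List.isChain_map]
  exact h.imp fun a b hab => ⟨by have := hab.1; omega, by have := hab.2; omega⟩

theorem isChain_reverse_near {l : List ℕ} (h : l.IsChain Near) : l.reverse.IsChain Near := by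
  rw [List.isChain_reverse]
  exact h.imp fun a b hab => hab.symm

theorem isChain_range_sub (n : ℕ) : ((List.range (n + 1)).map (n + 1 - ·)).IsChain Near := by
  rw [List.isChain_iff_getElem]
  intro i hi
  simp only [List.length_map, List.length_range] at hi
  simp only [List.getElem_map, List.getElem_range, Near]
  omega

/-- The part of `buildB3 A len` preceding its last block. -/
def frontB3 (A : List (List (ZMod 2))) (len : ℕ) : List (List (ZMod 2)) :=
  List.replicate len (0 : ZMod 2) ::
    (A.map (fun c => 0 :: c ++ [1]) ++ (A.reverse.map (fun c => 1 :: c ++ [1]) ++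
     A.map (fun c => 1 :: c ++ [0])))

theorem buildB3_eq (A : List (List (ZMod 2))) (len : ℕ) :
    buildB3 A len = frontB3 A len ++ A.tail.reverse.map (fun c => 0 :: c ++ [0]) := by
  simp [buildB3, frontB3]

theorem length_frontB3 (A : List (List (ZMod 2))) (len : ℕ) :
    (frontB3 A len).length = 3 * A.length + 1 := by
  simp [frontB3]; omega

theorem mem_frontB3 {A : List (List (ZMod 2))} {k : ℕ} {c : List (ZMod 2)} :
    c ∈ frontB3 A (k + 2) ↔ c = 0 :: (List.replicate k 0 ++ [0]) ∨
      (∃ a ∈ A, c = 0 :: (a ++ [1])) ∨ (∃ a ∈ A, c = 1 :: (a ++ [1])) ∨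
      ∃ a ∈ A, c = 1 :: (a ++ [0]) := by
  simp [frontB3, replicate_add_two_eq, eq_comm]

theorem injective_pad (x y : ZMod 2) :
    Function.Injective fun c : List (ZMod 2) => x :: c ++ [y] := fun _ _ h =>
  (cons_append_singleton_inj.1 h).2.1

theorem nodup_frontB3 {A : List (List (ZMod 2))} (hA : A.Nodup) (k : ℕ) :
    (frontB3 A (k + 2)).Nodup := by
  have hR : A.reverse.Nodup := List.nodup_reverse.2 hA
  rw [frontB3, List.nodup_cons, List.nodup_append', List.nodup_append']
  refine ⟨?_, hA.map (injective_pad 0 1), ⟨hR.map (injective_pad 1 1),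
    hA.map (injective_pad 1 0), ?_⟩, ?_⟩
  · simp [replicate_add_two_eq]
  · rw [List.disjoint_left]
    simp
  · rw [List.disjoint_left]
    simp

theorem nodup_frontB3_append {A R : List (List (ZMod 2))} {k : ℕ} (hA : A.Nodup) (hR : R.Nodup)
    (hz : List.replicate k 0 ∉ R) :
    (frontB3 A (k + 2) ++ R.reverse.map (fun c => 0 :: c ++ [0])).Nodup := by
  rw [List.nodup_append']
  refine ⟨nodup_frontB3 hA k, (List.nodup_reverse.2 hR).map (injective_pad 0 0), ?_⟩
  rw [List.disjoint_left]
  intro c hc hc'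
  simp only [List.mem_map, List.mem_reverse] at hc'
  obtain ⟨r, hr, rfl⟩ := hc'
  rw [mem_frontB3] at hc
  simp only [List.cons_append, cons_append_singleton_inj] at hc
  simp at hc
  exact hz (hc ▸ hr)

theorem flipPath_frontB3 {A : List (List (ZMod 2))} {k : ℕ} {D : List ℕ} {f : List (ZMod 2)}
    (h : FlipPath (List.replicate k 0) D f A) :
    FlipPath (List.replicate (k + 2) 0)
      ((k + 2) :: (D.map (· + 1) ++ 1 :: ((D.map (· + 1)).reverse ++ (k + 2) :: D.map (· + 1))))
      (1 :: f ++ [0]) (frontB3 A (k + 2)) := by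
  have h₁ : Flips (List.replicate (k + 2) 0) (0 :: List.replicate k 0 ++ [1]) (k + 2) :=
    ⟨0 :: List.replicate k 0, [], 0, by simp [replicate_add_two_eq], by simp, by simp⟩
  have h₂ : Flips (0 :: f ++ [1]) (1 :: f ++ [1]) 1 := ⟨[], f ++ [1], 0, by simp, by simp, by simp⟩
  have h₃ : Flips (1 :: List.replicate k 0 ++ [1]) (1 :: List.replicate k 0 ++ [0]) (k + 2) :=
    ⟨1 :: List.replicate k 0, [], 1, by simp, by simp; decide, by simp⟩
  have hr := (h.pad 1 1).reverse
  rw [← List.map_reverse (l := A)] at hr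
  exact .cons h₁ ((h.pad 0 1).append h₂ (hr.append h₃ (h.pad 1 0)))

/-- The properties of the codes `A_n` that are preserved by the recursion. -/
structure SkewInv (n : ℕ) (A : List (List (ZMod 2))) : Prop where
  nodup : A.Nodup
  length_word : ∀ c ∈ A, c.length = 2 * n + 2
  card : 2 * (A.length + 1) = 3 * 4 ^ n
  gap : ∀ j ≤ n, gapWord n j ∉ A
  path : ∃ T R pre es u f, A = T ++ R ∧ T.length = n ∧
    FlipPath (List.replicate (2 * n + 2) 0) pre u T ∧ Flips u (halfWord n) (n + 3) ∧
    FlipPath (halfWord n) es f R ∧ (pre ++ (n + 3) :: es).IsChain Near ∧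
    (pre ++ (n + 3) :: es).head? = some (2 * n + 2) ∧ es.getLast? = some 1 ∧
    es.head? = some (n + 2)

theorem skewInv_one : SkewInv 1 (c4A 1) where
  nodup := by decide
  length_word := by decide
  card := by decide
  gap := by decide
  path := by
    refine ⟨[[0,0,0,0]], [[0,0,0,1],[0,0,1,1],[0,1,1,1],[1,1,1,1]], [], [3, 2, 1],
      [0,0,0,0], [1,1,1,1], rfl, rfl, .single _, ⟨[0,0,0], [], 0, by decide, by decide, rfl⟩,
      .cons ⟨[0,0], [1], 0, by decide, by decide, rfl⟩
        (.cons ⟨[0], [1,1], 0, by decide, by decide, rfl⟩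
        (.cons ⟨[], [1,1,1], 0, by decide, by decide, rfl⟩ (.single _))), ?_, rfl, rfl, rfl⟩
    simp [Near]

theorem SkewInv.exists_cons {n : ℕ} {A : List (List (ZMod 2))} (h : SkewInv n A) :
    ∃ A₀ d D a f, A = List.replicate (2 * n + 2) 0 :: A₀ ∧ d = 2 * n + 2 ∧
      Flips (List.replicate (2 * n + 2) 0) a d ∧ FlipPath a D f A₀ ∧
      (d :: D).IsChain Near ∧ (d :: D).getLast? = some 1 := by
  obtain ⟨T, R, pre, es, u, f, rfl, hT, hp, hu, hq, hch, hhd, hlast, -⟩ := h.path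
  have hpath := hp.append hu hq
  have hl : (pre ++ (n + 3) :: es).getLast? = some 1 := by
    simp [List.getLast?_append, List.getLast?_cons, hlast]
  generalize pre ++ (n + 3) :: es = D at *
  generalize T ++ R = A at *
  cases hpath with
  | single => simp at hhd
  | cons h₁ h₂ => exact ⟨_, _, _, _, _, rfl, by simpa using hhd, h₁, h₂, hch, hl⟩

/-- The next code `A_{n+1}` after `A_n`. -/
def nextA (n : ℕ) (A : List (List (ZMod 2))) : List (List (ZMod 2)) :=
  (buildB3 A (2 * n + 4)).take ((buildB3 A (2 * n + 4)).length - (n - 1)) ++ newWordsE n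

theorem nextA_eq {n : ℕ} {T R : List (List (ZMod 2))} (hn : 1 ≤ n) (hT : T.length = n) :
    nextA n (T ++ R) = frontB3 (T ++ R) (2 * n + 4) ++
      R.reverse.map (fun c => 0 :: c ++ [0]) ++ newWordsE n := by
  obtain ⟨t, T, rfl⟩ := List.exists_cons_of_length_pos (l := T) (by omega)
  simp only [List.length_cons] at hT
  rw [nextA, buildB3_eq]
  simp only [List.cons_append, List.tail_cons, List.reverse_append, List.map_append]
  rw [← List.append_assoc (frontB3 _ _)]
  congr 1
  apply List.take_left'
  simp
  omega

theorem chain_front {k : ℕ} {D : List ℕ} (hch : D.IsChain Near) (hhd : D.head? = some k)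
    (hl : D.getLast? = some 1) :
    ((k + 2) :: (D.map (· + 1) ++ 1 :: ((D.map (· + 1)).reverse ++
      (k + 2) :: D.map (· + 1)))).IsChain Near := by
  have h' := isChain_map_succ hch
  have hr := isChain_reverse_near h'
  simp only [List.isChain_cons, List.isChain_append]
  simp [h', hr, hhd, hl, Near, List.head?_append, List.getLast?_reverse]

theorem SkewInv.next {n : ℕ} {A : List (List (ZMod 2))} (h : SkewInv n A) (hn : 1 ≤ n) :
    SkewInv (n + 1) (nextA n A) := by
  obtain ⟨A₀, -, -, -, -, hA₀, -⟩ := h.exists_cons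
  obtain ⟨T, R, pre, es, u, f, hTR, hT, hp, hu, hq, hch, hhd, hlast, heshd⟩ := h.path
  have heq : nextA n A = frontB3 A (2 * n + 4) ++ R.reverse.map (fun c => 0 :: c ++ [0]) ++
      newWordsE n := by
    rw [hTR]; exact nextA_eq hn hT
  have hRA : ∀ r ∈ R, r ∈ A := fun r hr => hTR ▸ List.mem_append_right _ hr
  have hmem : ∀ c ∈ nextA n A, c = 0 :: (List.replicate (2 * n + 2) 0 ++ [0]) ∨
      (∃ a ∈ A, c = 0 :: (a ++ [1])) ∨ (∃ a ∈ A, c = 1 :: (a ++ [1])) ∨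
      (∃ a ∈ A, c = 1 :: (a ++ [0])) ∨ (∃ a ∈ A, c = 0 :: (a ++ [0])) ∨
      (∃ j ≤ n, c = 0 :: (gapWord n j ++ [0])) ∨ c = 1 :: (gapWord n n ++ [0]) := by
    intro c hc
    rw [heq, List.mem_append, List.mem_append, mem_frontB3 (k := 2 * n + 2), mem_newWordsE,
      List.mem_map] at hc
    rcases hc with ((hc | hc | hc | hc) | ⟨r, hr, rfl⟩) | hc | hc
    · exact .inl hc
    · exact .inr (.inl hc)
    · exact .inr (.inr (.inl hc))
    · exact .inr (.inr (.inr (.inl hc)))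
    · exact .inr (.inr (.inr (.inr (.inl ⟨r, hRA r (List.mem_reverse.1 hr), rfl⟩))))
    · exact .inr (.inr (.inr (.inr (.inr (.inl hc)))))
    · exact .inr (.inr (.inr (.inr (.inr (.inr hc)))))
  have hgaplen : ∀ j ≤ n, (gapWord n j).length = 2 * n + 2 := by
    intro j hj
    simp [gapWord]; omega
  have hzA : List.replicate (2 * n + 2) 0 ∈ A := by simp [hA₀]
  refine ⟨?_, ?_, ?_, ?_, ?_⟩
  · have hzR : List.replicate (2 * n + 2) 0 ∉ R := by
      obtain ⟨T', rfl⟩ := hp.eq_cons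
      intro hr
      have := h.nodup
      rw [hTR, List.cons_append, List.nodup_cons] at this
      exact this.1 (List.mem_append_right _ hr)
    have hRn : R.Nodup := by
      have := h.nodup
      rw [hTR, List.nodup_append'] at this
      exact this.2.1
    rw [heq, List.nodup_append']
    refine ⟨nodup_frontB3_append (k := 2 * n + 2) h.nodup hRn hzR, nodup_newWordsE n, ?_⟩
    rw [List.disjoint_left]
    intro c hc hc'
    have hc₂ : c = 0 :: (List.replicate (2 * n + 2) 0 ++ [0]) ∨
      (∃ a ∈ A, c = 0 :: (a ++ [1])) ∨ (∃ a ∈ A, c = 1 :: (a ++ [1])) ∨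
      (∃ a ∈ A, c = 1 :: (a ++ [0])) ∨ (∃ a ∈ A, c = 0 :: (a ++ [0])) := by
      rw [List.mem_append, mem_frontB3 (k := 2 * n + 2), List.mem_map] at hc
      rcases hc with (hc | hc | hc | hc) | ⟨r, hr, rfl⟩
      · exact .inl hc
      · exact .inr (.inl hc)
      · exact .inr (.inr (.inl hc))
      · exact .inr (.inr (.inr (.inl hc)))
      · exact .inr (.inr (.inr (.inr ⟨r, hRA r (List.mem_reverse.1 hr), rfl⟩)))
    rw [mem_newWordsE] at hc'
    rcases hc' with ⟨j, hj, rfl⟩ | rfl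
    · have := h.gap j hj
      simp_all
    · have := h.gap n le_rfl
      simp_all
  · intro c hc
    rcases hmem c hc with rfl | ⟨a, ha, rfl⟩ | ⟨a, ha, rfl⟩ | ⟨a, ha, rfl⟩ | ⟨a, ha, rfl⟩ |
      ⟨j, hj, rfl⟩ | rfl
    · simp; omega
    · simp [h.length_word a ha]; omega
    · simp [h.length_word a ha]; omega
    · simp [h.length_word a ha]; omega
    · simp [h.length_word a ha]; omega
    · simp [hgaplen j hj]; omega
    · simp [hgaplen n le_rfl]; omega
  · have h₁ := h.card
    have h₂ : A.length = T.length + R.length := by simp [hTR]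
    rw [heq]
    simp only [List.length_append, length_frontB3, List.length_map, List.length_reverse,
      newWordsE, List.length_range]
    rw [pow_succ]
    omega
  · intro j hj hc
    have hm := hmem _ hc
    rcases Nat.lt_or_ge n j with hj' | hj'
    · obtain rfl : j = n + 1 := by omega
      have := h.gap n le_rfl
      rw [gapWord_succ_self] at hm
      simp_all
    · have := h.gap j hj'
      rw [gapWord_succ_of_le hj'] at hm
      simp_all
  · obtain ⟨e, hnew⟩ := flipPath_newWordsE n
    have hpath := hp.append hu hq
    have hD : (pre ++ (n + 3) :: es).getLast? = some 1 := by
      simp [List.getLast?_append, List.getLast?_cons, hlast]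
    have hstart : Flips (List.replicate (2 * n + 4) 0)
        (0 :: List.replicate (2 * n + 2) 0 ++ [1]) (2 * n + 4) :=
      ⟨0 :: List.replicate (2 * n + 2) 0, [], 0,
        by rw [replicate_add_two_eq (2 * n + 2)], by simp, by simp⟩
    have h₂ : Flips (0 :: f ++ [1]) (1 :: f ++ [1]) 1 :=
      ⟨[], f ++ [1], 0, by simp, by simp, by simp⟩
    have h₃ : Flips (1 :: List.replicate (2 * n + 2) 0 ++ [1])
        (1 :: List.replicate (2 * n + 2) 0 ++ [0]) (2 * n + 4) :=
      ⟨1 :: List.replicate (2 * n + 2) 0, [], 1, by simp, by simp; decide, by simp⟩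
    have h₄ : Flips (1 :: f ++ [0]) (0 :: f ++ [0]) 1 :=
      ⟨[], f ++ [0], 1, by simp, by simp; decide, by simp⟩
    have h₀ : 0 :: List.replicate (n + 2) (0 : ZMod 2) = List.replicate (n + 1) 0 ++ [0, 0] := by
      rw [← List.replicate_succ]
      exact List.replicate_add (n + 1) 2 0
    have h₅ : Flips (0 :: halfWord n ++ [0])
        (List.replicate (n + 1) 0 ++ [1, 0] ++ List.replicate n 1 ++ [0]) (n + 2) :=
      ⟨List.replicate (n + 1) 0, 0 :: (List.replicate n 1 ++ [0]), 0,
        by rw [halfWord, ← List.cons_append, h₀]; simp, by simp, by simp⟩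
    have hr := (hpath.pad 1 1).reverse
    have hRr := (hq.pad 0 0).reverse
    have htail := ((hq.pad 0 1).append h₂ (hr.append h₃ ((hpath.pad 1 0).append h₄
      (hRr.append h₅ hnew))))
    have hu' := hu.pad 0 1
    rw [← halfWord_succ] at hu' htail
    have hpre := FlipPath.cons hstart (hp.pad 0 1)
    refine ⟨_, _, _, _, _, _, ?_, ?_, hpre, hu', htail, ?_, ?_, ?_, ?_⟩
    · rw [heq, hTR]
      simp [frontB3]
    · simp [hT]
    · have c₁ := chain_front hch hhd hD
      have c₂ : es.IsChain Near := by
        have := (List.isChain_append.1 hch).2.1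
        exact (List.isChain_cons.1 this).2
      have c₃ := isChain_reverse_near (isChain_map_succ c₂)
      have c₄ := isChain_range_sub n
      have c₅ : ((n + 2) :: (List.range (n + 1)).map (n + 1 - ·)).IsChain Near := by
        rw [List.isChain_cons]
        refine ⟨?_, c₄⟩
        simp [List.range_succ_eq_map, Near]
      have c₆ : (((es.map (· + 1)).reverse) ++
          (n + 2) :: (List.range (n + 1)).map (n + 1 - ·)).IsChain Near := by
        rw [List.isChain_append]
        refine ⟨c₃, c₅, ?_⟩
        simp [List.getLast?_reverse, heshd, Near]
      have c₇ : (1 :: (((es.map (· + 1)).reverse) ++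
          (n + 2) :: (List.range (n + 1)).map (n + 1 - ·))).IsChain Near := by
        rw [List.isChain_cons]
        refine ⟨?_, c₆⟩
        simp [List.head?_append, List.head?_reverse, hlast, Near]
      have c₈ := List.isChain_append.2 ⟨c₁, c₇, by
        simp [List.getLast?_append, List.getLast?_cons, hlast, Near]⟩
      simpa using c₈
    · simp; omega
    · simp [List.getLast?_append, List.getLast?_cons, List.range_succ]
    · simp [heshd]

theorem skewInv_c4A (n : ℕ) : SkewInv (n + 1) (c4A (n + 1)) := by
  induction n with
  | zero => exact skewInv_one
  | succ n ih => exact ih.next (by omega)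

theorem SkewInv.length_buildB3 {n : ℕ} {A : List (List (ZMod 2))} (h : SkewInv n A) :
    (buildB3 A (2 * n + 4)).length = 4 * A.length := by
  obtain ⟨A₀, -, -, -, -, rfl, -⟩ := h.exists_cons
  rw [buildB3_eq, List.length_append, length_frontB3]
  simp
  omega

theorem SkewInv.length_of_mem_buildB3 {n : ℕ} {A : List (List (ZMod 2))} (h : SkewInv n A) :
    ∀ c ∈ buildB3 A (2 * n + 4), c.length = 2 * n + 4 := by
  intro c hc
  rw [buildB3_eq, List.mem_append, mem_frontB3 (k := 2 * n + 2), List.mem_map] at hc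
  rcases hc with (rfl | ⟨a, ha, rfl⟩ | ⟨a, ha, rfl⟩ | ⟨a, ha, rfl⟩) | ⟨a, ha, rfl⟩
  · simp
  · simp [h.length_word a ha]
  · simp [h.length_word a ha]
  · simp [h.length_word a ha]
  · simp [h.length_word a (List.mem_of_mem_tail (List.mem_reverse.1 ha))]

theorem SkewInv.exists_cyclicGrayZ {n : ℕ} {A : List (List (ZMod 2))} (h : SkewInv n A)
    (o : ℕ) : ∃ δ : ℕ → ℤ, CyclicGrayZ (buildB3 A (2 * n + 4)) o δ ∧
      ∀ i < (buildB3 A (2 * n + 4)).length,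
        |δ i - δ ((i + 1) % (buildB3 A (2 * n + 4)).length)| ≤ 1 := by
  obtain ⟨A₀, d, D, a, f, rfl, hd, ha, hp, hch, hl⟩ := h.exists_cons
  have hnd := h.nodup
  rw [List.nodup_cons] at hnd
  have hrev := (hp.pad 0 0).reverse
  have h₄ : Flips (1 :: f ++ [0]) (0 :: f ++ [0]) 1 :=
    ⟨[], f ++ [0], 1, by simp, by simp; decide, by simp⟩
  have hpath := (flipPath_frontB3 (FlipPath.cons ha hp)).append h₄ hrev
  have hclose := ha.symm.pad 0 0
  rw [← replicate_add_two_eq] at hclose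
  rw [buildB3_eq, List.tail_cons, List.map_reverse]
  refine hpath.exists_cyclicGrayZ hclose ?_ ?_ ?_ o
  · simpa using nodup_frontB3_append (k := 2 * n + 2) h.nodup hnd.2 hnd.1
  · have c₁ := chain_front hch (by simpa using hd) hl
    have c₂ := isChain_reverse_near (isChain_map_succ hch)
    have c₃ : (1 :: ((d :: D).map (· + 1)).reverse).IsChain Near := by
      rw [List.isChain_cons]
      refine ⟨?_, c₂⟩
      rw [List.head?_reverse, List.getLast?_map, hl]
      simp [Near]
    have c₄ := List.isChain_append.2 ⟨c₁, c₃, by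
      rw [List.getLast?_cons, List.getLast?_append, List.getLast?_cons, List.getLast?_append,
        List.getLast?_cons, List.getLast?_map, hl]
      simp [Near]⟩
    simpa using c₄
  · simp [hd, Near]

theorem stmt11 : ∀ n : ℕ, 2 ≤ n →
    (∀ c ∈ c4B n, c.length = 2*n+2) ∧
    8 * ((c4B n).length : ℤ) = 3 * 2 ^ (2*n+2) - 32 ∧
    ∃ δ : ℕ → ℤ, CyclicGrayZ (c4B n) (n+2) δ ∧
      ∀ i < (c4B n).length, |δ i - δ ((i+1) % (c4B n).length)| ≤ 1 := by
  intro n hn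
  obtain ⟨n, rfl⟩ : ∃ m, n = m + 2 := ⟨n - 2, by omega⟩
  have h := skewInv_c4A n
  have hB : c4B (n + 2) = buildB3 (c4A (n + 1)) (2 * (n + 1) + 4) := rfl
  rw [hB]
  refine ⟨h.length_of_mem_buildB3, ?_, h.exists_cyclicGrayZ _⟩
  rw [h.length_buildB3]
  have hc := h.card
  zify at hc
  have hp : (2 : ℤ) ^ (2 * (n + 2) + 2) = 16 * 4 ^ (n + 1) := by
    rw [show (4 : ℤ) = 2 ^ 2 by norm_num, ← pow_mul]
    ring
  rw [hp]
  push_cast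
  linarith
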